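/- arXiv:2311.13662 — 2 statements merged into one kernel-verified Lean document; each statement's English description precedes it below -/
import Mathlib

section
/- For all integers t ≥ 2, d ≥ 2, d* ≥ 2 and every real c > 0 there exists a constant C = C(t,d,d*,c) such that the following holds. Let G_{A,B} be a K_{t,t}-free bipartite graph with |A| = m ≥ 2 and |B| = n ≥ 2, whose shatter function satisfies π_G(ℓ) ≤ c·ℓ^d for all ℓ ≥ 1 and whose dual shatter function satisfies π*_G(ℓ) ≤ c·ℓ^{d*} for all ℓ ≥ 1. Then |E(G)| ≤ C · min{ m·n^{1−1/d} + n^{1+1/d}·log n , n·m^{1−1/d*} + m^{1+1/d*}·log m }. -/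
open scoped Classical
open Finset

/-- The two lowest-order terms of the binomial expansion of `(a + b) ^ (k + 1)`. -/
lemma pow_succ_add_mul_le_add_pow (a b k : ℕ) :
    a ^ (k + 1) + (k + 1) * b * a ^ k ≤ (a + b) ^ (k + 1) := by
  induction k with
  | zero => simp
  | succ k ih =>
    calc a ^ (k + 1 + 1) + (k + 1 + 1) * b * a ^ (k + 1)
        ≤ (a ^ (k + 1) + (k + 1) * b * a ^ k) * (a + b) := by
          have : 0 ≤ (k + 1) * b * a ^ k * b := Nat.zero_le _
          ring_nf at this ⊢
          omega
      _ ≤ (a + b) ^ (k + 1) * (a + b) := Nat.mul_le_mul_right _ ih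
      _ = (a + b) ^ (k + 1 + 1) := by ring

lemma mul_sub_pow_le_pow {m D k s : ℕ} (hm : 1 ≤ m) (hs : 1 ≤ s) (hD : D ≤ m)
    (hk : s * m ≤ k * D) : s * (m - D) ^ k ≤ m ^ k := by
  obtain ⟨a, rfl⟩ := Nat.exists_eq_add_of_le hD
  obtain _ | k := k
  · have : 0 < s * (D + a) := Nat.mul_pos hs hm
    omega
  rw [Nat.add_sub_cancel_left]
  calc s * a ^ (k + 1) = s * a * a ^ k := by ring
    _ ≤ s * (D + a) * a ^ k := by gcongr; omega
    _ ≤ (k + 1) * D * a ^ k := by gcongr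
    _ ≤ (a + D) ^ (k + 1) := le_trans (Nat.le_add_left _ _) (pow_succ_add_mul_le_add_pow a D k)
    _ = (D + a) ^ (k + 1) := by rw [add_comm]

/-- Few sequences of length `k` in `A` meet a large set `N` in fewer than `t` points. -/
lemma card_filter_inter_card_lt {α : Type*} [DecidableEq α] (A N : Finset α)
    (hN : N ⊆ A) (t D k : ℕ) (hcard : t * D ≤ N.card) :
    ((Fintype.piFinset fun _ : Fin k => A).filter
      fun f => (univ.image f ∩ N).card < t).card ≤ t * (A.card - D) ^ k := by
  obtain ⟨e⟩ : Nonempty (Fin t × Fin D ↪ N) :=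
    Function.Embedding.nonempty_of_card_le (by simpa using hcard)
  let P : Fin t → Finset α := fun i => univ.image fun j => (e (i, j) : α)
  have hPcard : ∀ i, (P i).card = D := fun i => by
    rw [card_image_of_injective, card_univ, Fintype.card_fin]
    intro j j' h
    simpa using e.injective (Subtype.ext h)
  have hPN : ∀ i, P i ⊆ N := fun i x hx => by
    obtain ⟨j, -, rfl⟩ := mem_image.1 hx
    exact (e (i, j)).2
  have hsub : ((Fintype.piFinset fun _ : Fin k => A).filter
      fun f => (univ.image f ∩ N).card < t) ⊆
      (univ : Finset (Fin t)).biUnion fun i => Fintype.piFinset fun _ : Fin k => A \ P i := by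
    intro f hf
    obtain ⟨hfA, hft⟩ := mem_filter.1 hf
    rw [Fintype.mem_piFinset] at hfA
    by_contra hcon
    have hhit : ∀ i, ∃ x, f x ∈ P i := fun i => by
      by_contra! h
      exact hcon (mem_biUnion.2 ⟨i, mem_univ _,
        Fintype.mem_piFinset.2 fun x => mem_sdiff.2 ⟨hfA x, h x⟩⟩)
    choose x hx using hhit
    have hinj : Function.Injective fun i => f (x i) := by
      intro i i' h
      obtain ⟨j, -, hj⟩ := mem_image.1 (hx i)
      obtain ⟨j', -, hj'⟩ := mem_image.1 (hx i')
      have := e.injective (Subtype.ext (hj.trans (h.trans hj'.symm)))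
      exact (Prod.ext_iff.1 this).1
    have hle : (univ.image fun i => f (x i)).card ≤ (univ.image f ∩ N).card := by
      refine card_le_card fun y hy => ?_
      obtain ⟨i, -, rfl⟩ := mem_image.1 hy
      exact mem_inter.2 ⟨mem_image_of_mem f (mem_univ _), hPN i (hx i)⟩
    rw [card_image_of_injective _ hinj, card_univ, Fintype.card_fin] at hle
    omega
  refine (card_le_card hsub).trans (card_biUnion_le.trans ?_)
  simp [Fintype.card_piFinset, card_sdiff_of_subset ((hPN _).trans hN), hPcard]

/-- A small set `S` meeting at least half of a family of large sets in at least `t` points. -/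
lemma exists_subset_card_le_rich {α β : Type*} [DecidableEq α] (A : Finset α)
    (B : Finset β) (N : β → Finset α) (hN : ∀ b ∈ B, N b ⊆ A) (t D k : ℕ) (hA : 1 ≤ A.card)
    (ht : 1 ≤ t) (hD : D ≤ A.card) (hcard : ∀ b ∈ B, t * D ≤ (N b).card)
    (hk : 2 * t * A.card ≤ k * D) :
    ∃ S ⊆ A, 1 ≤ S.card ∧ S.card ≤ k ∧
      B.card ≤ 2 * (B.filter fun b => t ≤ (S ∩ N b).card).card := by
  have hk0 : 0 < k := by
    rcases Nat.eq_zero_or_pos k with rfl | h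
    · have : 0 < 2 * t * A.card := by positivity
      omega
    · exact h
  let F := Fintype.piFinset fun _ : Fin k => A
  have hFcard : F.card = A.card ^ k := by simp [F, Fintype.card_piFinset]
  have hF : F.Nonempty := card_pos.1 (by rw [hFcard]; positivity)
  have hsum : ∑ f ∈ F, 2 * (B.filter fun b => (univ.image f ∩ N b).card < t).card
      ≤ ∑ _f ∈ F, B.card := by
    have hswap := sum_card_bipartiteAbove_eq_sum_card_bipartiteBelow (s := F) (t := B)
      (fun (f : Fin k → α) b => (univ.image f ∩ N b).card < t)
    simp only [bipartiteAbove, bipartiteBelow] at hswap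
    rw [← mul_sum, hswap, sum_const, smul_eq_mul, hFcard]
    calc 2 * ∑ b ∈ B, (F.filter fun f => (univ.image f ∩ N b).card < t).card
        ≤ 2 * ∑ _b ∈ B, t * (A.card - D) ^ k := by
          gcongr with b hb
          exact card_filter_inter_card_lt A (N b) (hN b hb) t D k (hcard b hb)
      _ = B.card * (2 * t * (A.card - D) ^ k) := by rw [sum_const, smul_eq_mul]; ring
      _ ≤ B.card * A.card ^ k := by
          gcongr
          exact mul_sub_pow_le_pow hA (by omega) hD hk
      _ = A.card ^ k * B.card := by ring
  obtain ⟨f, hf, hle⟩ := exists_le_of_sum_le hF hsum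
  have hfA := Fintype.mem_piFinset.1 hf
  refine ⟨univ.image f, fun y hy => ?_, ?_, ?_, ?_⟩
  · obtain ⟨x, -, rfl⟩ := mem_image.1 hy
    exact hfA x
  · exact card_pos.2 ⟨f ⟨0, hk0⟩, mem_image_of_mem f (mem_univ _)⟩
  · simpa using (card_image_le : (univ.image f).card ≤ _)
  · have := card_filter_add_card_filter_not (s := B)
      (fun b => (univ.image f ∩ N b).card < t)
    simp only [not_lt] at this
    omega

/-- In a `K_{t,t}`-free graph every large trace is attained by fewer than `t` vertices. -/
lemma card_rich_le_mul_card_image {α β : Type*} [DecidableEq α] [DecidableEq β]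
    (A : Finset α) (B B' : Finset β) (E : Finset (α × β)) (t : ℕ) (hB' : B' ⊆ B)
    (hfree : ¬ ∃ (S : Finset α) (T : Finset β), S ⊆ A ∧ T ⊆ B ∧
        S.card = t ∧ T.card = t ∧ ∀ a ∈ S, ∀ b ∈ T, (a, b) ∈ E)
    (S : Finset α) (hS : S ⊆ A) :
    (B'.filter fun b => t ≤ (S.filter fun a => (a, b) ∈ E).card).card ≤
      t * (B.image fun b => S.filter fun a => (a, b) ∈ E).card := by
  refine (card_le_mul_card_image (f := fun b => S.filter fun a => (a, b) ∈ E) _ t ?_).trans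
    (Nat.mul_le_mul_left _ (card_le_card (image_subset_image ((filter_subset _ _).trans hB'))))
  intro R hR
  obtain ⟨b₀, hb₀, rfl⟩ := mem_image.1 hR
  obtain ⟨-, hbt⟩ := mem_filter.1 hb₀
  by_contra! hlt
  obtain ⟨S', hS', hS'card⟩ := exists_subset_card_eq hbt
  obtain ⟨T, hT, hTcard⟩ := exists_subset_card_eq hlt.le
  refine hfree ⟨S', T, hS'.trans ((filter_subset _ _).trans hS), fun b hb => ?_,
    hS'card, hTcard, fun a ha b hb => ?_⟩
  · exact hB' (mem_filter.1 (mem_filter.1 (hT hb)).1).1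
  · have hab := hS' ha
    rw [← (mem_filter.1 (hT hb)).2] at hab
    exact (mem_filter.1 hab).2

lemma exists_degree_le {α β : Type*} [DecidableEq α] [DecidableEq β]
    (A : Finset α) (B B' : Finset β) (E : Finset (α × β)) (t d : ℕ) (c : ℝ)
    (hA : 1 ≤ A.card) (ht : 1 ≤ t) (hd : 1 ≤ d) (hc : 0 < c) (hB' : B' ⊆ B) (hne : B'.Nonempty)
    (hfree : ¬ ∃ (S : Finset α) (T : Finset β), S ⊆ A ∧ T ⊆ B ∧
        S.card = t ∧ T.card = t ∧ ∀ a ∈ S, ∀ b ∈ T, (a, b) ∈ E)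
    (hshatter : ∀ ℓ : ℕ, 1 ≤ ℓ → ∀ S ⊆ A, S.card = ℓ →
        (((B.image fun b => S.filter fun a => (a, b) ∈ E)).card : ℝ) ≤ c * (ℓ : ℝ) ^ d) :
    ∃ b ∈ B', ((A.filter fun a => (a, b) ∈ E).card : ℝ) ≤
      t * (3 * t * (2 * t * c) ^ (1 / (d : ℝ))) * A.card * (B'.card : ℝ) ^ (-(1 / (d : ℝ))) + t := by
  obtain ⟨b, hb, hmin⟩ := exists_min_image B' (fun b => (A.filter fun a => (a, b) ∈ E).card) hne
  refine ⟨b, hb, ?_⟩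
  set δ := (A.filter fun a => (a, b) ∈ E).card with hδ
  have hn : (0 : ℝ) < B'.card := by exact_mod_cast card_pos.2 hne
  have ht' : (0 : ℝ) < t := by exact_mod_cast ht
  set D := δ / t with hDdef
  have hδD : (δ : ℝ) ≤ t * D + t := by
    have := Nat.lt_mul_div_succ δ ht
    rw [← hDdef, mul_add, mul_one] at this
    exact_mod_cast this.le
  suffices hDle : (D : ℝ) ≤
      3 * t * (2 * t * c) ^ (1 / (d : ℝ)) * A.card * (B'.card : ℝ) ^ (-(1 / (d : ℝ))) by
    calc (δ : ℝ) ≤ t * D + t := hδD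
      _ ≤ t * (3 * t * (2 * t * c) ^ (1 / (d : ℝ)) * A.card
            * (B'.card : ℝ) ^ (-(1 / (d : ℝ)))) + t := by gcongr
      _ = _ := by ring
  rcases Nat.eq_zero_or_pos D with h0 | hDpos
  · rw [h0, Nat.cast_zero]
    positivity
  have htD : t * D ≤ δ := Nat.mul_div_le δ t
  have hDA : D ≤ A.card :=
    (Nat.le_mul_of_pos_left D ht).trans (htD.trans (card_le_card (filter_subset _ _)))
  set k := 2 * t * A.card / D + 1 with hkdef
  have hk : 2 * t * A.card ≤ k * D := by
    have := Nat.lt_mul_div_succ (2 * t * A.card) hDpos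
    exact this.le.trans_eq (mul_comm _ _)
  obtain ⟨S, hSA, hS1, hSk, hrich⟩ := exists_subset_card_le_rich A B'
    (fun b => A.filter fun a => (a, b) ∈ E) (fun _ _ => filter_subset _ _) t D k hA ht hDA
    (fun b' hb' => htD.trans (hmin b' hb')) hk
  have htrace : ∀ b, S ∩ (A.filter fun a => (a, b) ∈ E) = S.filter fun a => (a, b) ∈ E := by
    intro b
    rw [inter_filter, inter_eq_left.2 hSA]
  simp only [htrace] at hrich
  have hbound := card_rich_le_mul_card_image A B B' E t hB' hfree S hSA
  have hDpos' : (0 : ℝ) < D := by exact_mod_cast hDpos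
  have hkle : (k : ℝ) ≤ 3 * t * A.card / D := by
    have h1 : ((2 * t * A.card / D : ℕ) : ℝ) ≤ (2 * t * A.card : ℝ) / D := by
      exact_mod_cast (Nat.cast_div_le (α := ℝ) (m := 2 * t * A.card) (n := D))
    have h2 : (1 : ℝ) ≤ t * A.card / D := by
      rw [one_le_div hDpos']
      exact_mod_cast hDA.trans (Nat.le_mul_of_pos_left _ ht)
    rw [hkdef, Nat.cast_add, Nat.cast_one]
    calc _ ≤ (2 * t * A.card : ℝ) / D + t * A.card / D := add_le_add h1 h2
      _ = _ := by ring
  have hnle : (B'.card : ℝ) ≤ 2 * t * c * (3 * t * A.card / D) ^ d := by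
    have h1 : (B'.card : ℝ) ≤
        2 * (t * (B.image fun b => S.filter fun a => (a, b) ∈ E).card) := by
      exact_mod_cast hrich.trans (Nat.mul_le_mul_left _ hbound)
    have h2 := hshatter S.card hS1 S hSA rfl
    have h3 : (S.card : ℝ) ≤ 3 * t * A.card / D := le_trans (by exact_mod_cast hSk) hkle
    calc (B'.card : ℝ) ≤ 2 * (t * (c * (S.card : ℝ) ^ d)) := h1.trans (by gcongr)
      _ ≤ 2 * (t * (c * (3 * t * A.card / D) ^ d)) := by gcongr
      _ = _ := by ring
  have hroot : (B'.card : ℝ) ^ (1 / (d : ℝ)) ≤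
      (2 * t * c) ^ (1 / (d : ℝ)) * (3 * t * A.card / D) := by
    calc (B'.card : ℝ) ^ (1 / (d : ℝ))
        ≤ (2 * t * c * (3 * t * A.card / D) ^ d) ^ (1 / (d : ℝ)) := by gcongr
      _ = (2 * t * c) ^ (1 / (d : ℝ)) * (3 * t * A.card / D) := by
        rw [Real.mul_rpow (by positivity) (by positivity), one_div,
          Real.pow_rpow_inv_natCast (by positivity) (by omega)]
  rw [Real.rpow_neg hn.le, ← div_eq_mul_inv, le_div_iff₀ (by positivity)]
  calc (D : ℝ) * (B'.card : ℝ) ^ (1 / (d : ℝ))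
      ≤ D * ((2 * t * c) ^ (1 / (d : ℝ)) * (3 * t * A.card / D)) := by gcongr
    _ = _ := by field_simp

lemma rpow_add_half_mul_rpow_le {d : ℕ} (hd : 2 ≤ d) (n : ℕ) :
    (n : ℝ) ^ (1 - 1 / (d : ℝ)) + 1 / 2 * ((n + 1 : ℕ) : ℝ) ^ (-(1 / (d : ℝ))) ≤
      ((n + 1 : ℕ) : ℝ) ^ (1 - 1 / (d : ℝ)) := by
  have hd' : 1 / (d : ℝ) ≤ 1 / 2 := by
    have : (2 : ℝ) ≤ d := by exact_mod_cast hd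
    gcongr
  have hd0 : 0 ≤ 1 / (d : ℝ) := by positivity
  set p := 1 / (d : ℝ)
  have hN : (0 : ℝ) < ((n + 1 : ℕ) : ℝ) := by positivity
  have hn : (n : ℝ) = ((n + 1 : ℕ) : ℝ) - 1 := by push_cast; ring
  have hN1 : (1 : ℝ) ≤ ((n + 1 : ℕ) : ℝ) := by push_cast; linarith [Nat.cast_nonneg (α := ℝ) n]
  rw [hn]
  set N := ((n + 1 : ℕ) : ℝ)
  have hinv : N⁻¹ ≤ 1 := inv_le_one_of_one_le₀ hN1
  have hfac : N - 1 = N * (1 + -N⁻¹) := by field_simp; ring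
  have hsplit : N ^ (1 - p) = N * N ^ (-p) := by
    rw [sub_eq_add_neg, Real.rpow_add hN, Real.rpow_one]
  have hbern : (1 + -N⁻¹) ^ (1 - p) ≤ 1 + (1 - p) * -N⁻¹ :=
    rpow_one_add_le_one_add_mul_self (by linarith) (by linarith) (by linarith)
  rw [hfac, Real.mul_rpow hN.le (by linarith), hsplit]
  have hpos : 0 < N ^ (-p) := by positivity
  calc N * N ^ (-p) * (1 + -N⁻¹) ^ (1 - p) + 1 / 2 * N ^ (-p)
      ≤ N * N ^ (-p) * (1 + (1 - p) * -N⁻¹) + 1 / 2 * N ^ (-p) := by gcongr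
    _ = N * N ^ (-p) - (1 / 2 - p) * N ^ (-p) := by field_simp; ring
    _ ≤ N * N ^ (-p) := by nlinarith

lemma sum_degree_le {α β : Type*} [DecidableEq α] [DecidableEq β]
    (A : Finset α) (B : Finset β) (E : Finset (α × β)) (t d : ℕ) (c : ℝ)
    (hA : 1 ≤ A.card) (ht : 1 ≤ t) (hd : 2 ≤ d) (hc : 0 < c)
    (hfree : ¬ ∃ (S : Finset α) (T : Finset β), S ⊆ A ∧ T ⊆ B ∧
        S.card = t ∧ T.card = t ∧ ∀ a ∈ S, ∀ b ∈ T, (a, b) ∈ E)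
    (hshatter : ∀ ℓ : ℕ, 1 ≤ ℓ → ∀ S ⊆ A, S.card = ℓ →
        (((B.image fun b => S.filter fun a => (a, b) ∈ E)).card : ℝ) ≤ c * (ℓ : ℝ) ^ d)
    (n : ℕ) (B' : Finset β) (hB' : B' ⊆ B) (hn : B'.card = n) :
    ∑ b ∈ B', ((A.filter fun a => (a, b) ∈ E).card : ℝ) ≤
      2 * (t * (3 * t * (2 * t * c) ^ (1 / (d : ℝ)))) * A.card * (n : ℝ) ^ (1 - 1 / (d : ℝ))
        + t * n := by
  induction n generalizing B' with
  | zero =>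
    rw [card_eq_zero.1 hn, sum_empty]
    positivity
  | succ n ih =>
    obtain ⟨b, hb, hdeg⟩ := exists_degree_le A B B' E t d c hA ht (by omega) hc hB'
      (card_pos.1 (by omega)) hfree hshatter
    have hrest := ih (B'.erase b) ((erase_subset _ _).trans hB') (by rw [card_erase_of_mem hb]; omega)
    have hstep := rpow_add_half_mul_rpow_le hd n
    rw [hn] at hdeg
    rw [← add_sum_erase _ _ hb]
    have hK : 0 ≤ t * (3 * t * (2 * t * c) ^ (1 / (d : ℝ))) * A.card := by positivity
    generalize t * (3 * t * (2 * t * c) ^ (1 / (d : ℝ))) = K at *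
    have := mul_le_mul_of_nonneg_left hstep hK
    push_cast at *
    linarith

lemma card_edges_le {α β : Type*} [DecidableEq α] [DecidableEq β]
    (A : Finset α) (B : Finset β) (E : Finset (α × β)) (t d : ℕ) (c : ℝ)
    (hE : E ⊆ A ×ˢ B) (hA : 1 ≤ A.card) (hB : 2 ≤ B.card) (ht : 1 ≤ t) (hd : 2 ≤ d) (hc : 0 < c)
    (hfree : ¬ ∃ (S : Finset α) (T : Finset β), S ⊆ A ∧ T ⊆ B ∧
        S.card = t ∧ T.card = t ∧ ∀ a ∈ S, ∀ b ∈ T, (a, b) ∈ E)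
    (hshatter : ∀ ℓ : ℕ, 1 ≤ ℓ → ∀ S ⊆ A, S.card = ℓ →
        (((B.image fun b => S.filter fun a => (a, b) ∈ E)).card : ℝ) ≤ c * (ℓ : ℝ) ^ d) :
    (E.card : ℝ) ≤ (2 * (t * (3 * t * (2 * t * c) ^ (1 / (d : ℝ)))) + 2 * t) *
      (A.card * (B.card : ℝ) ^ (1 - 1 / (d : ℝ))
        + (B.card : ℝ) ^ (1 + 1 / (d : ℝ)) * Real.log B.card) := by
  have hsum := sum_degree_le A B E t d c hA ht hd hc hfree hshatter B.card B Subset.rfl rfl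
  have hcount : E.card = ∑ b ∈ B, (A.filter fun a => (a, b) ∈ E).card := by
    rw [card_eq_sum_card_fiberwise (f := Prod.snd) (t := B)
      fun x hx => (mem_product.1 (hE hx)).2]
    refine sum_congr rfl fun b _ => ?_
    refine card_bij (fun x _ => x.1) ?_ ?_ ?_
    · rintro ⟨a, b'⟩ hx
      obtain ⟨hab, rfl⟩ := mem_filter.1 hx
      exact mem_filter.2 ⟨(mem_product.1 (hE hab)).1, hab⟩
    · rintro ⟨a, b'⟩ hx ⟨a', b''⟩ hx' h
      exact Prod.ext h ((mem_filter.1 hx).2.trans (mem_filter.1 hx').2.symm)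
    · intro a ha
      exact ⟨(a, b), mem_filter.2 ⟨(mem_filter.1 ha).2, rfl⟩, rfl⟩
  have hlin : (B.card : ℝ) ≤ 2 * ((B.card : ℝ) ^ (1 + 1 / (d : ℝ)) * Real.log B.card) := by
    have hn : (2 : ℝ) ≤ B.card := by exact_mod_cast hB
    have hlog : 1 / 2 ≤ Real.log B.card := by
      have := Real.log_two_gt_d9
      have := Real.log_le_log (by norm_num) hn
      linarith
    have hpow : (B.card : ℝ) ≤ (B.card : ℝ) ^ (1 + 1 / (d : ℝ)) := by
      conv_lhs => rw [← Real.rpow_one (B.card : ℝ)]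
      exact Real.rpow_le_rpow_of_exponent_le (by linarith) (by simp)
    nlinarith
  have hmain : 0 ≤ (A.card : ℝ) * (B.card : ℝ) ^ (1 - 1 / (d : ℝ)) := by positivity
  have hK : 0 ≤ t * (3 * t * (2 * t * c) ^ (1 / (d : ℝ))) := by positivity
  have ht0 : (0 : ℝ) ≤ t := Nat.cast_nonneg t
  have hlog0 : 0 ≤ (B.card : ℝ) ^ (1 + 1 / (d : ℝ)) * Real.log B.card := by positivity
  rw [hcount, Nat.cast_sum]
  refine hsum.trans ?_
  generalize t * (3 * t * (2 * t * c) ^ (1 / (d : ℝ))) = K at *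
  have := mul_le_mul_of_nonneg_left hlin ht0
  have := mul_nonneg ht0 hmain
  have := mul_nonneg hK hlog0
  linarith

theorem stmt_4 (t d dstar : ℕ) (ht : 2 ≤ t) (hd : 2 ≤ d) (hdstar : 2 ≤ dstar)
    (c : ℝ) (hc : 0 < c) :
    ∃ C : ℝ, ∀ (α β : Type) [DecidableEq α] [DecidableEq β]
      (A : Finset α) (B : Finset β) (E : Finset (α × β)) (m n : ℕ),
      E ⊆ A ×ˢ B → A.card = m → B.card = n → 2 ≤ m → 2 ≤ n →
      (¬ ∃ (S : Finset α) (T : Finset β), S ⊆ A ∧ T ⊆ B ∧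
        S.card = t ∧ T.card = t ∧ ∀ a ∈ S, ∀ b ∈ T, (a, b) ∈ E) →
      (∀ ℓ : ℕ, 1 ≤ ℓ → ∀ S ⊆ A, S.card = ℓ →
        (((B.image fun b => S.filter fun a => (a, b) ∈ E)).card : ℝ) ≤ c * (ℓ : ℝ) ^ d) →
      (∀ ℓ : ℕ, 1 ≤ ℓ → ∀ S ⊆ B, S.card = ℓ →
        (((A.image fun a => S.filter fun b => (a, b) ∈ E)).card : ℝ) ≤ c * (ℓ : ℝ) ^ dstar) →
      (E.card : ℝ) ≤ C * min
        ((m : ℝ) * (n : ℝ) ^ (1 - 1 / (d : ℝ)) + (n : ℝ) ^ (1 + 1 / (d : ℝ)) * Real.log n)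
        ((n : ℝ) * (m : ℝ) ^ (1 - 1 / (dstar : ℝ)) + (m : ℝ) ^ (1 + 1 / (dstar : ℝ)) * Real.log m) := by
  refine ⟨max (2 * (t * (3 * t * (2 * t * c) ^ (1 / (d : ℝ)))) + 2 * t)
    (2 * (t * (3 * t * (2 * t * c) ^ (1 / (dstar : ℝ)))) + 2 * t), ?_⟩
  rintro α β _ _ A B E m n hE rfl rfl hm hn hfree hshatter hdual
  have hprimal := card_edges_le A B E t d c hE (by omega) hn (by omega) hd hc hfree hshatter
  have hmem : ∀ a b, (b, a) ∈ E.map (Equiv.prodComm α β).toEmbedding ↔ (a, b) ∈ E := by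
    simp
  have hflip := card_edges_le B A (E.map (Equiv.prodComm α β).toEmbedding) t dstar c
    (by
      rintro ⟨b, a⟩ hx
      have := mem_product.1 (hE ((hmem a b).1 hx))
      exact mem_product.2 ⟨this.2, this.1⟩)
    (by omega) hm (by omega) hdstar hc
    (by
      rintro ⟨S, T, hS, hT, hSc, hTc, h⟩
      exact hfree ⟨T, S, hT, hS, hTc, hSc, fun a ha b hb => (hmem a b).1 (h b hb a ha)⟩)
    (by simpa only [hmem] using hdual)
  rw [card_map] at hflip
  rw [mul_min_of_nonneg _ _ (le_max_of_le_left (by positivity))]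
  refine le_min (hprimal.trans ?_) (hflip.trans ?_)
  · exact mul_le_mul_of_nonneg_right (le_max_left _ _) (by positivity)
  · exact mul_le_mul_of_nonneg_right (le_max_right _ _) (by positivity)
end

section
/- There exists an absolute constant c > 0 such that the following holds for every integer t ≥ 2. Let A and B be finite families of axis-parallel rectangles in the plane with |A| = n, |B| = m, n + m ≥ 16, such that A ∪ B is in general position. If the bipartite intersection graph G_{A,B} is K_{t,t}-free, then |E(G_{A,B})| ≤ c·( t·(n+m)·log(n+m)/log log(n+m) + t⁶·n + t·m ). -/
open scoped Classical
open Finset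

/-- An axis-parallel rectangle `[x₁,x₂] × [y₁,y₂]` with `x₁ < x₂` and `y₁ < y₂`. -/
structure Rect where
  x1 : ℝ
  x2 : ℝ
  y1 : ℝ
  y2 : ℝ
  hx : x1 < x2
  hy : y1 < y2

/-- The set of points of an axis-parallel rectangle. -/
def Rect.toSet (r : Rect) : Set (ℝ × ℝ) :=
  Set.Icc r.x1 r.x2 ×ˢ Set.Icc r.y1 r.y2

/-- A family of axis-parallel rectangles is in general position if the x-coordinates of all
vertical edges are pairwise distinct and the y-coordinates of all horizontal edges are
pairwise distinct. -/
def GenPos (F : Finset Rect) : Prop :=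
  ∀ r ∈ F, ∀ s ∈ F, r ≠ s →
    ({r.x1, r.x2} ∩ {s.x1, s.x2} : Set ℝ) = ∅ ∧
    ({r.y1, r.y2} ∩ {s.y1, s.y2} : Set ℝ) = ∅

/-- The number of pairs in `A × B` related by `E`. -/
noncomputable def edgeCount {α β : Type*} (A : Finset α) (B : Finset β) (E : α → β → Prop) : ℕ :=
  ((A ×ˢ B).filter fun p => E p.1 p.2).card

/-- The bipartite graph with parts `A`, `B` and edge relation `E` is `K_{t,t}`-free. -/
def BicliqueFree {α β : Type*} (t : ℕ) (A : Finset α) (B : Finset β) (E : α → β → Prop) : Prop :=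
  ¬ ∃ (S : Finset α) (T : Finset β), S ⊆ A ∧ T ⊆ B ∧ S.card = t ∧ T.card = t ∧
    ∀ a ∈ S, ∀ b ∈ T, E a b

/-- Intersecting `R` with any one-sided comparison of integer labels gives a relation whose
`K_{t,t}`-free finite restrictions have linearly many edges. -/
def HasLinearBound {α β : Type*} (t : ℕ) (R : α → β → Prop) : Prop :=
  ∀ (h : α → ℤ) (k : β → ℤ) (A : Finset α) (B : Finset β),
    BicliqueFree t A B (fun u v => h u ≤ k v ∧ R u v) →
      edgeCount A B (fun u v => h u ≤ k v ∧ R u v) ≤ 2 * t * (A.card + B.card)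

section Bipartite

variable {α β : Type*} {t : ℕ} {A A' : Finset α} {B B' : Finset β} {E E' R : α → β → Prop}

lemma BicliqueFree.mono (hfree : BicliqueFree t A B E) (hA : A' ⊆ A) (hB : B' ⊆ B)
    (hE : ∀ u ∈ A', ∀ v ∈ B', E' u v → E u v) : BicliqueFree t A' B' E' := by
  rintro ⟨S, T, hS, hT, hSc, hTc, hST⟩
  exact hfree ⟨S, T, hS.trans hA, hT.trans hB, hSc, hTc,
    fun a ha b hb => hE a (hS ha) b (hT hb) (hST a ha b hb)⟩

lemma BicliqueFree.swap (hfree : BicliqueFree t A B E) :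
    BicliqueFree t B A (fun v u => E u v) := by
  rintro ⟨S, T, hS, hT, hSc, hTc, hST⟩
  exact hfree ⟨T, S, hT, hS, hTc, hSc, fun a ha b hb => hST b hb a ha⟩

lemma edgeCount_le_add {E₁ E₂ : α → β → Prop}
    (hE : ∀ u ∈ A, ∀ v ∈ B, E u v → E₁ u v ∨ E₂ u v) :
    edgeCount A B E ≤ edgeCount A B E₁ + edgeCount A B E₂ := by
  refine le_trans (card_le_card fun p hp => ?_) (card_union_le _ _)
  simp only [mem_filter, mem_product, mem_union] at hp ⊢
  have := hE _ hp.1.1 _ hp.1.2 hp.2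
  tauto

lemma edgeCount_eq_sum_left :
    edgeCount A B E = ∑ u ∈ A, (B.filter fun v => E u v).card := by
  simp only [edgeCount, card_filter, sum_product]

lemma edgeCount_eq_sum_right :
    edgeCount A B E = ∑ v ∈ B, (A.filter fun u => E u v).card := by
  simp only [edgeCount, card_filter, sum_product_right]

lemma edgeCount_swap : edgeCount B A (fun v u => E u v) = edgeCount A B E := by
  rw [edgeCount_eq_sum_left, edgeCount_eq_sum_right]

lemma edgeCount_filter_right (P : β → Prop) [DecidablePred P] :
    edgeCount A B E = edgeCount A (B.filter P) E + edgeCount A (B.filter fun v => ¬ P v) E := by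
  simp only [edgeCount_eq_sum_right]
  exact (sum_filter_add_sum_filter_not B P _).symm

/-- Points versus rectangles unbounded in one direction: either some rectangle contains at most
`2 * t` points, or the extreme point lies in at most `2 * t` rectangles. -/
lemma hasLinearBound_point_mem_Icc (t : ℕ) (g : α → ℝ) (lo hi : β → ℝ) :
    HasLinearBound t (fun u v => lo v ≤ g u ∧ g u ≤ hi v) := by
  intro h k A B
  obtain ⟨E, hE⟩ : ∃ E : α → β → Prop, E = fun u v => h u ≤ k v ∧ lo v ≤ g u ∧ g u ≤ hi v :=
    ⟨_, rfl⟩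
  have hEiff : ∀ u v, E u v ↔ h u ≤ k v ∧ lo v ≤ g u ∧ g u ≤ hi v := fun u v => by rw [hE]
  rw [← hE]
  clear hE
  induction hs : A.card + B.card generalizing A B with
  | zero =>
    intro _
    have hA : A = ∅ := card_eq_zero.mp (by omega)
    simp [edgeCount, hA]
  | succ s ih =>
    intro hfree
    by_cases hB : ∃ v ∈ B, (A.filter fun u => E u v).card ≤ 2 * t
    · obtain ⟨v, hv, hdeg⟩ := hB
      have hcard := card_erase_add_one hv
      have key := ih A (B.erase v) (by omega)
        (hfree.mono (Subset.refl _) (erase_subset _ _) fun _ _ _ _ h => h)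
      rw [edgeCount_eq_sum_right] at key ⊢
      rw [← add_sum_erase B _ hv]
      calc _ ≤ 2 * t + 2 * t * s := add_le_add hdeg key
        _ = 2 * t * (s + 1) := by ring
    push Not at hB
    rcases A.eq_empty_or_nonempty with rfl | hne
    · simp [edgeCount]
    obtain ⟨p, hp, hmax⟩ := exists_max_image A h hne
    have hdeg : (B.filter fun v => E p v).card ≤ 2 * t := by
      by_contra! hlt
      set N := B.filter fun v => E p v with hN
      have hNB : ∀ v ∈ N, v ∈ B ∧ E p v := fun v hv => by simpa [hN] using hv
      set L := N.filter fun v => t ≤ (A.filter fun u => E u v ∧ g u ≤ g p).card with hL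
      set M := N.filter fun v => ¬ t ≤ (A.filter fun u => E u v ∧ g u ≤ g p).card with hM
      have hLM : L.card + M.card = N.card := card_filter_add_card_filter_not _
      have hMt : ∀ v ∈ M, t ≤ (A.filter fun u => E u v ∧ ¬ g u ≤ g p).card := by
        intro v hv
        rw [hM, mem_filter] at hv
        have h1 := hB v (hNB v hv.1).1
        have h2 := card_filter_add_card_filter_not (s := A.filter fun u => E u v)
          (fun u => g u ≤ g p)
        simp only [filter_filter] at h2
        omega
      rcases (by omega : t ≤ L.card ∨ t ≤ M.card) with hc | hc
      · obtain ⟨T, hTL, hTc⟩ := exists_subset_card_eq hc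
        rcases T.eq_empty_or_nonempty with rfl | hT
        · exact hfree ⟨∅, ∅, by simp, by simp, by simpa using hTc, by simpa using hTc, by simp⟩
        obtain ⟨w, hw, hwmax⟩ := exists_max_image T lo hT
        have hwL := hTL hw
        rw [hL, mem_filter] at hwL
        obtain ⟨S, hS, hSc⟩ := exists_subset_card_eq hwL.2
        refine hfree ⟨S, T, hS.trans (filter_subset _ _),
          fun v hv => (hNB v (mem_filter.mp (hTL hv)).1).1, hSc, hTc, fun u hu v hv => ?_⟩
        have h1 := mem_filter.mp (hS hu)
        rw [hEiff] at h1
        have h2 := (hNB v (mem_filter.mp (hTL hv)).1).2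
        rw [hEiff] at h2 ⊢
        have h3 := hwmax v hv
        have h4 := hmax u h1.1
        exact ⟨h4.trans h2.1, h3.trans h1.2.1.2.1, h1.2.2.trans h2.2.2⟩
      · obtain ⟨T, hTM, hTc⟩ := exists_subset_card_eq hc
        rcases T.eq_empty_or_nonempty with rfl | hT
        · exact hfree ⟨∅, ∅, by simp, by simp, by simpa using hTc, by simpa using hTc, by simp⟩
        obtain ⟨w, hw, hwmin⟩ := exists_min_image T hi hT
        obtain ⟨S, hS, hSc⟩ := exists_subset_card_eq (hMt w (hTM hw))
        refine hfree ⟨S, T, hS.trans (filter_subset _ _),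
          fun v hv => (hNB v (mem_filter.mp (hTM hv)).1).1, hSc, hTc, fun u hu v hv => ?_⟩
        have h1 := mem_filter.mp (hS hu)
        rw [hEiff] at h1
        have h2 := (hNB v (mem_filter.mp (hTM hv)).1).2
        rw [hEiff] at h2 ⊢
        have h3 := hwmin v hv
        have h4 := hmax u h1.1
        exact ⟨h4.trans h2.1, h2.2.1.trans (not_le.mp h1.2.2).le, h1.2.1.2.2.trans h3⟩
    have hcard := card_erase_add_one hp
    have key := ih (A.erase p) B (by omega)
      (hfree.mono (erase_subset _ _) (Subset.refl _) fun _ _ _ _ h => h)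
    rw [edgeCount_eq_sum_left] at key ⊢
    rw [← add_sum_erase A _ hp]
    calc _ ≤ 2 * t + 2 * t * s := add_le_add hdeg key
      _ = 2 * t * (s + 1) := by ring

lemma HasLinearBound.swap (hR : HasLinearBound t R) : HasLinearBound t (fun v u => R u v) := by
  intro h k B A hfree
  have hneg : ∀ (u : α) (v : β), h v ≤ k u ∧ R u v ↔ -k u ≤ -h v ∧ R u v := fun u v => by
    rw [neg_le_neg_iff]
  simp only [hneg] at hfree ⊢
  have := hR (fun u => -k u) (fun v => -h v) A B hfree.swap
  rw [← edgeCount_swap] at this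
  rw [add_comm B.card]
  exact this

/-- Splitting `A` into the fibres of `φ`, where `v` can only be joined to the fibres over
the at most `w` values `s` with `Q s v`. -/
lemma HasLinearBound.edgeCount_fibers (hR : HasLinearBound t R) (hfree : BicliqueFree t A B E)
    (φ : α → ℕ) (Q : ℕ → β → Prop) (h : α → ℤ) (k : β → ℤ) (F : α → β → Prop) (w : ℕ)
    (hw : ∀ v ∈ B, ∀ S : Finset ℕ, (S.filter fun s => Q s v).card ≤ w)
    (hF : ∀ u ∈ A, ∀ v ∈ B, F u v → Q (φ u) v ∧ h u ≤ k v ∧ R u v)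
    (hE : ∀ u ∈ A, ∀ v ∈ B, Q (φ u) v → h u ≤ k v → R u v → E u v) :
    edgeCount A B F ≤ 2 * t * (A.card + w * B.card) := by
  have hsplit : edgeCount A B F = ∑ s ∈ A.image φ, edgeCount (A.filter fun u => φ u = s) B F := by
    simp only [edgeCount_eq_sum_left]
    exact (sum_fiberwise_of_maps_to (fun u hu => mem_image_of_mem φ hu) _).symm
  have hpiece : ∀ s ∈ A.image φ, edgeCount (A.filter fun u => φ u = s) B F ≤
      2 * t * ((A.filter fun u => φ u = s).card + (B.filter fun v => Q s v).card) := by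
    intro s _
    refine le_trans ?_ (hR h k _ _ (hfree.mono (filter_subset _ _) (filter_subset _ _) ?_))
    · refine card_le_card fun p hp => ?_
      simp only [mem_filter, mem_product] at hp ⊢
      obtain ⟨⟨⟨hu, rfl⟩, hv⟩, hp⟩ := hp
      obtain ⟨h1, h2⟩ := hF _ hu _ hv hp
      exact ⟨⟨⟨hu, rfl⟩, hv, h1⟩, h2⟩
    · intro u hu v hv huv
      obtain ⟨huA, rfl⟩ := mem_filter.mp hu
      obtain ⟨hvB, hq⟩ := mem_filter.mp hv
      exact hE u huA v hvB hq huv.1 huv.2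
  have hA : ∑ s ∈ A.image φ, (A.filter fun u => φ u = s).card = A.card :=
    (card_eq_sum_card_image φ A).symm
  have hB : ∑ s ∈ A.image φ, (B.filter fun v => Q s v).card ≤ w * B.card := by
    rw [← edgeCount_eq_sum_left, edgeCount_eq_sum_right, mul_comm]
    exact sum_le_card_nsmul _ _ _ fun v hv => hw v hv _
  rw [hsplit]
  refine (sum_le_sum hpiece).trans ?_
  rw [← mul_sum, sum_add_distrib, hA]
  gcongr

/-- Divide and conquer with branching factor `b`: at depth `d`, the endpoints of every interval
agree up to their last `d` digits in base `b`. -/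
lemma HasLinearBound.edgeCount_digits (hR : HasLinearBound t R) (i : α → ℕ) (l r : β → ℕ)
    {b : ℕ} (hb : 0 < b) (d : ℕ) (B : Finset β)
    (hfree : BicliqueFree t A B (fun u v => (l v ≤ i u ∧ i u ≤ r v) ∧ R u v))
    (hlr : ∀ v ∈ B, l v ≤ r v) (hd : ∀ v ∈ B, l v / b ^ d = r v / b ^ d) :
    edgeCount A B (fun u v => (l v ≤ i u ∧ i u ≤ r v) ∧ R u v) ≤
      6 * t * ((d + 1) * A.card + b * B.card) := by
  induction d generalizing B with
  | zero =>
    simp only [pow_zero, Nat.div_one] at hd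
    have := hR.edgeCount_fibers hfree i (fun s v => s = l v) 0 0
      (fun u v => (l v ≤ i u ∧ i u ≤ r v) ∧ R u v) 1
      (fun v _ S => card_le_one.mpr (by simp +contextual))
      (fun u _ v hv huv => ⟨by have := hd v hv; omega, le_rfl, huv.2⟩)
      (fun u _ v hv hq _ huv => ⟨by have := hd v hv; omega, huv⟩)
    refine this.trans ?_
    have : 1 * B.card ≤ b * B.card := by gcongr; omega
    nlinarith
  | succ d ih =>
    set E : α → β → Prop := fun u v => (l v ≤ i u ∧ i u ≤ r v) ∧ R u v with hE
    set q := b ^ d with hq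
    have hq0 : 0 < q := by positivity
    set B₁ := B.filter fun v => l v / q = r v / q with hB₁
    set B₂ := B.filter fun v => ¬ l v / q = r v / q with hB₂
    have hcard : B₁.card + B₂.card = B.card := card_filter_add_card_filter_not _
    have h₁ : edgeCount A B₁ E ≤ 6 * t * ((d + 1) * A.card + b * B₁.card) :=
      ih B₁ (hfree.mono (Subset.refl _) (filter_subset _ _) fun _ _ _ _ h => h)
        (fun v hv => hlr v (mem_filter.mp hv).1) (fun v hv => (mem_filter.mp hv).2)
    have hfree₂ : BicliqueFree t A B₂ E :=
      hfree.mono (Subset.refl _) (filter_subset _ _) fun _ _ _ _ h => h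
    have hlt : ∀ v ∈ B₂, l v / q < r v / q := fun v hv => by
      obtain ⟨hv, hne⟩ := mem_filter.mp hv
      exact lt_of_le_of_ne (Nat.div_le_div_right (hlr v hv)) hne
    have hwidth : ∀ v ∈ B₂, r v / q < l v / q + b := fun v hv => by
      have h := hd v (mem_filter.mp hv).1
      rw [pow_succ, ← Nat.div_div_eq_div_mul, ← Nat.div_div_eq_div_mul] at h
      have h1 := Nat.div_add_mod (l v / q) b
      have h2 := Nat.div_add_mod (r v / q) b
      have h3 := Nat.mod_lt (r v / q) hb
      rw [← hq] at h
      rw [h] at h1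
      omega
    have hdiv : ∀ {x y : ℕ}, x / q < y / q → x ≤ y := fun {x y} h => by
      by_contra! hc
      exact absurd (Nat.div_le_div_right (c := q) hc.le) (not_le.mpr h)
    have hleft := hR.edgeCount_fibers hfree₂ (fun u => i u / q) (fun s v => s = l v / q)
      (fun u => -(i u : ℤ)) (fun v => -(l v : ℤ)) (fun u v => E u v ∧ i u / q = l v / q) 1
      (fun v _ S => card_le_one.mpr (by simp +contextual))
      (fun u _ v _ huv => ⟨huv.2, by have := huv.1.1.1; omega, huv.1.2⟩)
      (fun u _ v hv hs hle huv => ⟨⟨by omega, hdiv (by rw [hs]; exact hlt v hv)⟩, huv⟩)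
    have hright := hR.edgeCount_fibers hfree₂ (fun u => i u / q) (fun s v => s = r v / q)
      (fun u => (i u : ℤ)) (fun v => (r v : ℤ)) (fun u v => E u v ∧ i u / q = r v / q) 1
      (fun v _ S => card_le_one.mpr (by simp +contextual))
      (fun u _ v _ huv => ⟨huv.2, by have := huv.1.1.2; omega, huv.1.2⟩)
      (fun u _ v hv hs hle huv => ⟨⟨hdiv (by rw [hs]; exact hlt v hv), by omega⟩, huv⟩)
    have hmid := hR.edgeCount_fibers hfree₂ (fun u => i u / q)
      (fun s v => l v / q < s ∧ s < r v / q) 0 0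
      (fun u v => E u v ∧ l v / q < i u / q ∧ i u / q < r v / q) b
      (fun v hv S => by
        have hlen := hwidth v hv
        refine (card_le_card (t := Ioo (l v / q) (r v / q)) fun s hs => ?_).trans ?_
        · simp only [mem_filter] at hs
          exact mem_Ioo.mpr hs.2
        · rw [Nat.card_Ioo]
          omega)
      (fun u _ v _ huv => ⟨huv.2, le_rfl, huv.1.2⟩)
      (fun u _ v hv hs _ huv => ⟨⟨hdiv hs.1, hdiv hs.2⟩, huv⟩)
    have h₂ : edgeCount A B₂ E ≤ edgeCount A B₂ (fun u v => E u v ∧ i u / q = l v / q) +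
        (edgeCount A B₂ (fun u v => E u v ∧ i u / q = r v / q) +
          edgeCount A B₂ (fun u v => E u v ∧ l v / q < i u / q ∧ i u / q < r v / q)) := by
      refine (edgeCount_le_add (E₂ := fun u v => E u v ∧ i u / q ≠ l v / q)
        fun u _ v _ huv => by tauto).trans (Nat.add_le_add_left (edgeCount_le_add ?_) _)
      intro u _ v _ huv
      have h1 : l v / q ≤ i u / q := Nat.div_le_div_right huv.1.1.1
      have h2 : i u / q ≤ r v / q := Nat.div_le_div_right huv.1.1.2
      rcases h2.eq_or_lt with h | h
      · exact Or.inl ⟨huv.1, h⟩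
      · exact Or.inr ⟨huv.1, lt_of_le_of_ne h1 huv.2.symm, h⟩
    have hb1 : B₂.card ≤ b * B₂.card := Nat.le_mul_of_pos_left _ hb
    have hsplit : edgeCount A B E = edgeCount A B₁ E + edgeCount A B₂ E :=
      edgeCount_filter_right fun v => l v / q = r v / q
    rw [one_mul] at hleft hright
    rw [hsplit, ← hcard]
    calc _ ≤ 6 * t * ((d + 1) * A.card + b * B₁.card) + (2 * t * (A.card + b * B₂.card) +
          (2 * t * (A.card + b * B₂.card) + 2 * t * (A.card + b * B₂.card))) := by
          refine add_le_add h₁ (h₂.trans (add_le_add (hleft.trans ?_)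
            (add_le_add (hright.trans ?_) hmid))) <;> gcongr
      _ = _ := by ring

/-- Real interval membership, handled by replacing real values with their ranks in `A`. -/
lemma HasLinearBound.edgeCount_interval (hR : HasLinearBound t R) (f : α → ℝ) (l r : β → ℝ)
    {b d : ℕ} (hb : 0 < b) (hd : A.card < b ^ d)
    (hfree : BicliqueFree t A B (fun u v => (l v ≤ f u ∧ f u ≤ r v) ∧ R u v)) :
    edgeCount A B (fun u v => (l v ≤ f u ∧ f u ≤ r v) ∧ R u v) ≤
      6 * t * ((d + 1) * A.card + b * B.card) := by
  set i : α → ℕ := fun u => (A.filter fun x => f x < f u).card with hi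
  set l' : β → ℕ := fun v => (A.filter fun x => f x < l v).card with hl'
  set r' : β → ℕ := fun v => (A.filter fun x => f x ≤ r v).card with hr'
  have hl : ∀ u ∈ A, ∀ v, l v ≤ f u ↔ l' v + 1 ≤ i u + 1 := by
    intro u hu v
    constructor
    · intro h
      refine Nat.succ_le_succ (card_le_card fun x hx => ?_)
      simp only [mem_filter] at hx ⊢
      exact ⟨hx.1, hx.2.trans_le h⟩
    · contrapose!
      intro h
      refine Nat.succ_lt_succ (card_lt_card ⟨fun x hx => ?_, fun hsub => ?_⟩)
      · simp only [mem_filter] at hx ⊢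
        exact ⟨hx.1, hx.2.trans h⟩
      · exact lt_irrefl _ (mem_filter.mp (hsub (mem_filter.mpr ⟨hu, h⟩))).2
  have hr : ∀ u ∈ A, ∀ v, f u ≤ r v ↔ i u + 1 ≤ r' v := by
    intro u hu v
    constructor
    · intro h
      refine card_lt_card ⟨fun x hx => ?_, fun hsub => ?_⟩
      · simp only [mem_filter] at hx ⊢
        exact ⟨hx.1, hx.2.le.trans h⟩
      · exact lt_irrefl _ (mem_filter.mp (hsub (mem_filter.mpr ⟨hu, h⟩))).2
    · contrapose!
      intro h
      refine Nat.lt_succ_of_le (card_le_card fun x hx => ?_)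
      simp only [mem_filter] at hx ⊢
      exact ⟨hx.1, hx.2.trans_lt h⟩
  set B₀ := B.filter fun v => l' v + 1 ≤ r' v with hB₀
  have hrank : edgeCount A B (fun u v => (l v ≤ f u ∧ f u ≤ r v) ∧ R u v) ≤
      edgeCount A B₀ (fun u v => (l' v + 1 ≤ i u + 1 ∧ i u + 1 ≤ r' v) ∧ R u v) := by
    refine card_le_card fun p hp => ?_
    simp only [mem_filter, mem_product, hB₀] at hp ⊢
    obtain ⟨⟨hu, hv⟩, ⟨h1, h2⟩, h3⟩ := hp
    rw [hl _ hu] at h1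
    rw [hr _ hu] at h2
    exact ⟨⟨hu, hv, h1.trans h2⟩, ⟨h1, h2⟩, h3⟩
  have hr'lt : ∀ v, r' v < b ^ d := fun v => (card_filter_le _ _).trans_lt hd
  have hcount := hR.edgeCount_digits (A := A) (fun u => i u + 1) (fun v => l' v + 1) r' hb d B₀
    (hfree.mono (Subset.refl _) (filter_subset _ _) fun u hu v _ h => by
      rw [hl u hu, hr u hu]; exact h)
    (fun v hv => (mem_filter.mp hv).2)
    (fun v hv => by
      rw [Nat.div_eq_of_lt (hr'lt v),
        Nat.div_eq_of_lt ((mem_filter.mp hv).2.trans_lt (hr'lt v))])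
  refine hrank.trans (hcount.trans ?_)
  have : B₀.card ≤ B.card := card_filter_le _ _
  gcongr

end Bipartite

lemma Rect.inter_nonempty_iff (a b : Rect) : (a.toSet ∩ b.toSet).Nonempty ↔
    (a.x1 ≤ b.x2 ∧ b.x1 ≤ a.x2) ∧ (a.y1 ≤ b.y2 ∧ b.y1 ≤ a.y2) := by
  have ha := a.hx
  have ha' := a.hy
  have hb := b.hx
  have hb' := b.hy
  simp only [Rect.toSet, Set.prod_inter_prod, Set.prod_nonempty_iff, Set.Icc_inter_Icc,
    Set.nonempty_Icc, sup_le_iff, le_inf_iff]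
  constructor
  · rintro ⟨⟨⟨_, h1⟩, h2, _⟩, ⟨_, h3⟩, h4, _⟩
    tauto
  · rintro ⟨⟨h1, h2⟩, h3, h4⟩
    exact ⟨⟨⟨ha.le, by assumption⟩, by assumption, hb.le⟩,
      ⟨ha'.le, by assumption⟩, by assumption, hb'.le⟩

/-- Two rectangles meet iff in each coordinate the lower end of one of them lies in the projection
of the other; each of the four combinations is a point-rectangle or a segment-segment incidence. -/
lemma edgeCount_rect_le {t b d : ℕ} {A B : Finset Rect} (hb : 0 < b) (hA : A.card < b ^ d)
    (hB : B.card < b ^ d)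
    (hfree : BicliqueFree t A B fun u v => (u.toSet ∩ v.toSet).Nonempty) :
    edgeCount A B (fun u v => (u.toSet ∩ v.toSet).Nonempty) ≤
      12 * t * ((d + 1 + b) * (A.card + B.card)) := by
  set X : Rect → Rect → Prop := fun u v => v.x1 ≤ u.x1 ∧ u.x1 ≤ v.x2 with hX
  set Y : Rect → Rect → Prop := fun u v => v.y1 ≤ u.y1 ∧ u.y1 ≤ v.y2 with hY
  have hYbd : HasLinearBound t Y := hasLinearBound_point_mem_Icc t Rect.y1 Rect.y1 Rect.y2
  have hXi : ∀ u v : Rect, X u v → u.x1 ≤ v.x2 ∧ v.x1 ≤ u.x2 :=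
    fun u v h => ⟨h.2, h.1.trans u.hx.le⟩
  have hYi : ∀ u v : Rect, Y u v → u.y1 ≤ v.y2 ∧ v.y1 ≤ u.y2 :=
    fun u v h => ⟨h.2, h.1.trans u.hy.le⟩
  have hcover : edgeCount A B (fun u v => (u.toSet ∩ v.toSet).Nonempty) ≤
      (edgeCount A B (fun u v => X u v ∧ Y u v) + edgeCount A B (fun u v => X u v ∧ Y v u)) +
      (edgeCount A B (fun u v => X v u ∧ Y u v) + edgeCount A B (fun u v => X v u ∧ Y v u)) := by
    refine (edgeCount_le_add (E₁ := fun u v => X u v ∧ (Y u v ∨ Y v u))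
      (E₂ := fun u v => X v u ∧ (Y u v ∨ Y v u)) ?_).trans
      (add_le_add (edgeCount_le_add ?_) (edgeCount_le_add ?_))
    · intro u _ v _ huv
      rw [Rect.inter_nonempty_iff] at huv
      obtain ⟨⟨h1, h2⟩, h3, h4⟩ := huv
      have hx : X u v ∨ X v u := (le_total v.x1 u.x1).imp (⟨·, h1⟩) (⟨·, h2⟩)
      have hy : Y u v ∨ Y v u := (le_total v.y1 u.y1).imp (⟨·, h3⟩) (⟨·, h4⟩)
      exact hx.imp (⟨·, hy⟩) (⟨·, hy⟩)
    · intro u _ v _ huv; tauto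
    · intro u _ v _ huv; tauto
  have hfree' : ∀ F : Rect → Rect → Prop,
      (∀ u v, F u v → (u.x1 ≤ v.x2 ∧ v.x1 ≤ u.x2) ∧ (u.y1 ≤ v.y2 ∧ v.y1 ≤ u.y2)) →
      BicliqueFree t A B F := fun F hF =>
    hfree.mono (Subset.refl _) (Subset.refl _) fun u _ v _ h =>
      (Rect.inter_nonempty_iff u v).mpr (hF u v h)
  have h₁ := hYbd.edgeCount_interval Rect.x1 Rect.x1 Rect.x2 hb hA
    (hfree' (fun u v => X u v ∧ Y u v) fun u v h => ⟨hXi _ _ h.1, hYi _ _ h.2⟩)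
  have h₂ := hYbd.swap.edgeCount_interval Rect.x1 Rect.x1 Rect.x2 hb hA
    (hfree' (fun u v => X u v ∧ Y v u) fun u v h => ⟨hXi _ _ h.1, (hYi _ _ h.2).symm⟩)
  have h₃ := hYbd.swap.edgeCount_interval Rect.x1 Rect.x1 Rect.x2 hb hB
    (hfree' (fun u v => X v u ∧ Y u v) fun u v h => ⟨(hXi _ _ h.1).symm, hYi _ _ h.2⟩).swap
  have h₄ := hYbd.edgeCount_interval Rect.x1 Rect.x1 Rect.x2 hb hB
    (hfree' (fun u v => X v u ∧ Y v u)
      fun u v h => ⟨(hXi _ _ h.1).symm, (hYi _ _ h.2).symm⟩).swap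
  have e₃ := edgeCount_swap (A := A) (B := B) (E := fun u v => X v u ∧ Y u v)
  have e₄ := edgeCount_swap (A := A) (B := B) (E := fun u v => X v u ∧ Y v u)
  rw [← e₃, ← e₄] at hcover
  refine hcover.trans ((add_le_add (add_le_add h₁ h₂) (add_le_add h₃ h₄)).trans (le_of_eq ?_))
  ring

/-- A branching factor near `√(log N)` balances the depth of the recursion against the width. -/
lemma exists_branching {N : ℕ} (hN : 16 ≤ N) : ∃ b d : ℕ, 0 < b ∧ N < b ^ d ∧
    ((d + 1 + b : ℕ) : ℝ) ≤ 10 * (Real.log N / Real.log (Real.log N)) := by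
  have hN' : (16 : ℝ) ≤ N := by exact_mod_cast hN
  set L := Real.log N with hL
  have hL1 : 2 < L := by
    have h16 : Real.log 16 = 4 * Real.log 2 := by
      rw [show (16 : ℝ) = 2 ^ 4 by norm_num, Real.log_pow]; norm_num
    have := Real.log_two_gt_d9
    have : Real.log 16 ≤ L := Real.log_le_log (by norm_num) hN'
    linarith
  have hLL : 0 < Real.log L := Real.log_pos (by linarith)
  set s := Real.sqrt L with hs
  have hs0 : 0 < s := Real.sqrt_pos.mpr (by linarith)
  have hss : s * s = L := Real.mul_self_sqrt (by linarith)
  have hs1 : 1 < s := by nlinarith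
  have hlogs : Real.log L = 2 * Real.log s := by
    rw [← hss, Real.log_mul hs0.ne' hs0.ne']; ring
  have hlogs_pos : 0 < Real.log s := by linarith
  set ρ := L / Real.log L with hρ
  have hsρ : s ≤ 2 * ρ := by
    have := Real.log_le_sub_one_of_pos hs0
    rw [hρ, ← mul_div_assoc, le_div_iff₀ hLL, hlogs]
    nlinarith
  have hρ1 : 1 ≤ ρ := by
    rw [hρ, one_le_div hLL]
    linarith [Real.log_le_sub_one_of_pos (show 0 < L by linarith)]
  refine ⟨⌈s⌉₊, ⌊L / Real.log s⌋₊ + 1, Nat.ceil_pos.mpr hs0, ?_, ?_⟩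
  · have hsb : s ≤ ⌈s⌉₊ := Nat.le_ceil s
    have hd := Nat.lt_floor_add_one (L / Real.log s)
    rw [div_lt_iff₀ hlogs_pos] at hd
    have : (N : ℝ) < s ^ (⌊L / Real.log s⌋₊ + 1) := by
      rw [← Real.log_lt_log_iff (by linarith) (by positivity), Real.log_pow]
      exact_mod_cast hd
    have h2 : s ^ (⌊L / Real.log s⌋₊ + 1) ≤ (⌈s⌉₊ : ℝ) ^ (⌊L / Real.log s⌋₊ + 1) := by gcongr
    exact_mod_cast this.trans_le h2
  · have h1 : (⌈s⌉₊ : ℝ) < s + 1 := Nat.ceil_lt_add_one hs0.le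
    have h2 : (⌊L / Real.log s⌋₊ : ℝ) ≤ L / Real.log s := Nat.floor_le (by positivity)
    have h3 : L / Real.log s = 2 * ρ := by
      rw [hρ, hlogs]; field_simp
    push_cast
    linarith

theorem stmt_9 :
    ∃ c : ℝ, 0 < c ∧ ∀ t : ℕ, 2 ≤ t → ∀ (A B : Finset Rect) (n m : ℕ),
      A.card = n → B.card = m → 16 ≤ n + m → GenPos (A ∪ B) →
      (¬ ∃ (S T : Finset Rect), S ⊆ A ∧ T ⊆ B ∧ S.card = t ∧ T.card = t ∧
        ∀ a ∈ S, ∀ b ∈ T, (a.toSet ∩ b.toSet).Nonempty) →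
      ((((A ×ˢ B).filter fun p => (p.1.toSet ∩ p.2.toSet).Nonempty).card : ℝ)
        ≤ c * ((t : ℝ) * ((n : ℝ) + m) * Real.log ((n : ℝ) + m)
              / Real.log (Real.log ((n : ℝ) + m))
            + (t : ℝ) ^ 6 * n + (t : ℝ) * m)) := by
  refine ⟨120, by norm_num, ?_⟩
  rintro t - A B n m rfl rfl hN - hfree
  obtain ⟨b, d, hb, hd, hbd⟩ := exists_branching hN
  have hcount := edgeCount_rect_le hb ((Nat.le_add_right _ _).trans_lt hd)
    ((Nat.le_add_left _ _).trans_lt hd) hfree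
  rw [edgeCount] at hcount
  have hcount' := (Nat.cast_le (α := ℝ)).mpr hcount
  push_cast at hcount' hbd
  refine hcount'.trans ?_
  have hrest : (0 : ℝ) ≤ (t : ℝ) ^ 6 * A.card + t * B.card := by positivity
  calc 12 * (t : ℝ) * ((d + 1 + b) * (A.card + B.card))
      ≤ 12 * t * (10 * (Real.log (A.card + B.card) / Real.log (Real.log (A.card + B.card))) *
          (A.card + B.card)) := by gcongr
    _ = 120 * (t * (A.card + B.card) * Real.log (A.card + B.card) /
          Real.log (Real.log (A.card + B.card))) := by ring
    _ ≤ _ := by linarith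
end
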